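/- arXiv:2101.00360 — 7 statements merged into one kernel-verified Lean document; each statement's English description precedes it below -/
import Mathlib

section
/- Let X be a real-valued random variable on a probability space with E[X] = 0 and X ∈ [a, b] almost surely, where a < 0 < b. Then for every real s > 0 and every integer k ≥ 1, E[exp(sX)] ≤ Υ_k(a,b) · exp( (s²/(2k)) · Φ(a,b)² ), where Υ_k(a,b) = (1 + max(|a|,b)/|a|)^k − k·max(|a|,b)/|a| and Φ(a,b) = (|a|+b)/2 if b > |a| and Φ(a,b) = √(|a|·b) if b ≤ |a|. -/
open MeasureTheory Real ProbabilityTheory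
open scoped ProbabilityTheory

/-- `Φ(a,b)`: the coefficient in the improved Hoeffding inequality. -/
noncomputable def Phi (a b : ℝ) : ℝ := if b > |a| then (|a| + b) / 2 else Real.sqrt (|a| * b)

/-- `Υ_k(a,b)`: the multiplicative factor in the new-type Hoeffding inequality. -/
noncomputable def Upsilon (k : ℕ) (a b : ℝ) : ℝ :=
  (1 + max |a| b / |a|) ^ k - (k : ℝ) * (max |a| b / |a|)

/-- The moment generating function of the centred distribution supported on `{a, b}`. -/
noncomputable def twoPointMGF (a b s : ℝ) : ℝ :=
  (-a * exp (s * b) + b * exp (s * a)) / (b - a)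

lemma integral_exp_le_twoPointMGF {Ω : Type*} [MeasurableSpace Ω] {μ : Measure Ω}
    [IsProbabilityMeasure μ] {X : Ω → ℝ} {a b : ℝ} (hX : AEMeasurable X μ) (hab : a < b)
    (hmem : ∀ᵐ ω ∂μ, X ω ∈ Set.Icc a b) (hmean : ∫ ω, X ω ∂μ = 0) (s : ℝ) :
    ∫ ω, exp (s * X ω) ∂μ ≤ twoPointMGF a b s := by
  have hba : 0 < b - a := sub_pos.2 hab
  have hint : Integrable X μ := Integrable.of_mem_Icc a b hX hmem
  have hchord : ∀ᵐ ω ∂μ, exp (s * X ω) ≤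
      X ω * ((exp (s * b) - exp (s * a)) / (b - a)) + twoPointMGF a b s := by
    filter_upwards [hmem] with ω hω
    have h := convexOn_exp.2 (Set.mem_univ (s * a)) (Set.mem_univ (s * b))
      (div_nonneg (sub_nonneg.2 hω.2) hba.le) (div_nonneg (sub_nonneg.2 hω.1) hba.le)
      (by field_simp; ring)
    simp only [smul_eq_mul] at h
    have hx : (b - X ω) / (b - a) * (s * a) + (X ω - a) / (b - a) * (s * b) = s * X ω := by
      field_simp; ring
    rw [hx] at h
    refine h.trans (le_of_eq ?_)
    unfold twoPointMGF
    field_simp; ring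
  calc ∫ ω, exp (s * X ω) ∂μ
      ≤ ∫ ω, (X ω * ((exp (s * b) - exp (s * a)) / (b - a)) + twoPointMGF a b s) ∂μ :=
        integral_mono_ae (integrable_exp_mul_of_mem_Icc hX hmem)
          ((hint.mul_const _).add (integrable_const _)) hchord
    _ = twoPointMGF a b s := by
        rw [integral_add (hint.mul_const _) (integrable_const _), integral_mul_const, hmean]
        simp

lemma twoPointMGF_le_exp_sq_width {a b : ℝ} (ha : a < 0) (hb : 0 < b) (s : ℝ) :
    twoPointMGF a b s ≤ exp (s ^ 2 / 2 * ((b - a) / 2) ^ 2) := by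
  have hba : 0 < b - a := by linarith
  have hp : 0 ≤ -a / (b - a) := div_nonneg (by linarith) hba.le
  have hq : 0 ≤ b / (b - a) := div_nonneg hb.le hba.le
  set μ : Measure ℝ := ENNReal.ofReal (-a / (b - a)) • Measure.dirac b +
    ENNReal.ofReal (b / (b - a)) • Measure.dirac a with hμ
  have : IsProbabilityMeasure μ := ⟨by
    simp only [hμ, Measure.add_apply, Measure.smul_apply, measure_univ, smul_eq_mul, mul_one]
    rw [← ENNReal.ofReal_add hp hq, ← add_div, neg_add_eq_sub, div_self hba.ne',
      ENNReal.ofReal_one]⟩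
  have hintegral (f : ℝ → ℝ) : ∫ x, f x ∂μ = (-a * f b + b * f a) / (b - a) := by
    rw [hμ, integral_add_measure, integral_smul_measure, integral_smul_measure, integral_dirac,
      integral_dirac, ENNReal.toReal_ofReal hp, ENNReal.toReal_ofReal hq]
    · simp only [smul_eq_mul]; ring
    · exact (integrable_dirac (by simp)).smul_measure ENNReal.ofReal_ne_top
    · exact (integrable_dirac (by simp)).smul_measure ENNReal.ofReal_ne_top
  have hmem : ∀ᵐ x ∂μ, id x ∈ Set.Icc a b := by
    rw [hμ, ae_add_measure_iff]
    constructor <;> refine Measure.ae_smul_measure ?_ _ <;> rw [ae_dirac_eq] <;>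
      simp <;> linarith
  have h := (hasSubgaussianMGF_of_mem_Icc_of_integral_eq_zero aemeasurable_id hmem
    (by simp only [id, hintegral]; ring)).mgf_le s
  simp only [mgf, id, hintegral] at h
  refine h.trans_eq ?_
  congr 1
  simp [abs_of_pos hba]
  ring

lemma one_sub_exp_neg_le {x : ℝ} (hx : 0 ≤ x) : 1 - exp (-x) ≤ x * (1 + exp (-x)) / 2 := by
  have hderiv (y : ℝ) : HasDerivAt (fun y ↦ y * (1 + exp (-y)) / 2 + exp (-y))
      ((1 - (1 + y) * exp (-y)) / 2) y := by
    have he : HasDerivAt (fun y ↦ exp (-y)) (exp (-y) * -1) y := (hasDerivAt_neg y).exp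
    exact ((((hasDerivAt_id y).mul (he.const_add 1)).div_const 2).add he).congr_deriv
      (by simp only [id]; ring)
  have hmono : MonotoneOn (fun y ↦ y * (1 + exp (-y)) / 2 + exp (-y)) (Set.Ici 0) := by
    refine monotoneOn_of_deriv_nonneg (convex_Ici 0)
      (fun y _ ↦ (hderiv y).continuousAt.continuousWithinAt)
      (fun y _ ↦ (hderiv y).differentiableAt.differentiableWithinAt) fun y _ ↦ ?_
    rw [(hderiv y).deriv]
    have h := mul_le_mul_of_nonneg_right (add_one_le_exp y) (exp_pos (-y)).le
    rw [← exp_add, add_neg_cancel, exp_zero] at h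
    linarith
  have h := hmono (Set.mem_Ici.2 le_rfl) (Set.mem_Ici.2 hx) hx
  simp only [zero_mul, neg_zero, exp_zero] at h
  linarith

lemma twoPointMGF_le_exp_variance {a b s : ℝ} (hb : 0 < b) (hab : b ≤ -a) (hs : 0 ≤ s) :
    twoPointMGF a b s ≤ exp (s ^ 2 / 2 * (-a * b)) := by
  have hba : 0 < b - a := by linarith
  have hderiv (t : ℝ) :
      HasDerivAt (fun t ↦ twoPointMGF a b t * exp (-(t ^ 2 / 2 * (-a * b))))
        (-a * b / (b - a) * exp (t * b) * exp (-(t ^ 2 / 2 * (-a * b))) *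
          (1 - exp (-(t * (b - a))) - t * (-a + b * exp (-(t * (b - a)))))) t := by
    have h₁ : HasDerivAt (fun t ↦ exp (t * b)) (exp (t * b) * (1 * b)) t :=
      ((hasDerivAt_id t).mul_const b).exp
    have h₂ : HasDerivAt (fun t ↦ exp (t * a)) (exp (t * a) * (1 * a)) t :=
      ((hasDerivAt_id t).mul_const a).exp
    have h₃ : HasDerivAt (fun t ↦ exp (-(t ^ 2 / 2 * (-a * b))))
        (exp (-(t ^ 2 / 2 * (-a * b))) * -(t * (-a * b))) t :=
      ((((hasDerivAt_pow 2 t).div_const 2).mul_const (-a * b)).neg.exp).congr_deriv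
        (by simp only [Pi.neg_apply]; push_cast; ring)
    have hexp : exp (t * a) = exp (t * b) * exp (-(t * (b - a))) := by
      rw [← exp_add]; ring_nf
    refine ((((h₁.const_mul (-a)).add (h₂.const_mul b)).div_const (b - a)).mul h₃).congr_deriv ?_
    simp only [Pi.add_apply, hexp]
    field_simp
    ring
  have hanti : AntitoneOn (fun t ↦ twoPointMGF a b t * exp (-(t ^ 2 / 2 * (-a * b))))
      (Set.Ici 0) := by
    refine antitoneOn_of_deriv_nonpos (convex_Ici 0)
      (fun t _ ↦ (hderiv t).continuousAt.continuousWithinAt)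
      (fun t _ ↦ (hderiv t).differentiableAt.differentiableWithinAt) fun t ht ↦ ?_
    rw [(hderiv t).deriv]
    have ht : 0 ≤ t := interior_subset ht
    have ha : 0 < -a := hb.trans_le hab
    refine mul_nonpos_of_nonneg_of_nonpos (by positivity) ?_
    have hx : 0 ≤ t * (b - a) := by positivity
    have h := one_sub_exp_neg_le hx
    have hle : exp (-(t * (b - a))) ≤ 1 := exp_le_one_iff.2 (neg_nonpos.2 hx)
    nlinarith [mul_nonneg ht (mul_nonneg (sub_nonneg.2 hab) (sub_nonneg.2 hle))]
  have h := hanti (Set.mem_Ici.2 le_rfl) (Set.mem_Ici.2 hs) hs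
  have h₀ : twoPointMGF a b 0 = 1 := by
    simp only [twoPointMGF, zero_mul, exp_zero, mul_one]
    rw [neg_add_eq_sub, div_self hba.ne']
  simp only [h₀, one_mul] at h
  rw [exp_neg, ← div_eq_mul_inv] at h
  simpa using (div_le_iff₀ (exp_pos _)).1 h

lemma twoPointMGF_le_exp_Phi {a b s : ℝ} (ha : a < 0) (hb : 0 < b) (hs : 0 ≤ s) :
    twoPointMGF a b s ≤ exp (s ^ 2 / 2 * Phi a b ^ 2) := by
  unfold Phi
  rw [abs_of_neg ha]
  split_ifs with h
  · rw [neg_add_eq_sub]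
    exact twoPointMGF_le_exp_sq_width ha hb s
  · rw [sq_sqrt (mul_nonneg (neg_pos.2 ha).le hb.le)]
    exact twoPointMGF_le_exp_variance hb (not_lt.1 h) hs

lemma twoPointMGF_nat_mul_le {a b s : ℝ} (ha : a < 0) (hb : 0 < b) (hs : 0 ≤ s) (n : ℕ) :
    twoPointMGF a b ((n + 1 : ℕ) * s) ≤ (1 + b / -a) ^ n * twoPointMGF a b s ^ (n + 1) := by
  have hba : 0 < b - a := by linarith
  have ha' : 0 < -a := neg_pos.2 ha
  have hexp : exp (s * b) ≤ (1 + b / -a) * twoPointMGF a b s := by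
    have : (1 + b / -a) * twoPointMGF a b s = exp (s * b) + b / -a * exp (s * a) := by
      unfold twoPointMGF
      field_simp [ha.ne]
      ring
    rw [this]
    exact le_add_of_nonneg_right (by positivity)
  have hle : exp (s * a) ≤ exp (s * b) := exp_le_exp.2 (by nlinarith)
  have hm : 0 ≤ twoPointMGF a b s := by unfold twoPointMGF; positivity
  have hpow (x : ℝ) : exp ((n + 1 : ℕ) * s * x) = exp (s * x) ^ n * exp (s * x) := by
    rw [← pow_succ, ← exp_nat_mul]; ring_nf
  calc twoPointMGF a b ((n + 1 : ℕ) * s)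
      = (-a * (exp (s * b) ^ n * exp (s * b)) + b * (exp (s * a) ^ n * exp (s * a))) / (b - a) := by
        rw [twoPointMGF, hpow, hpow]
    _ ≤ (-a * (exp (s * b) ^ n * exp (s * b)) + b * (exp (s * b) ^ n * exp (s * a))) / (b - a) := by
        gcongr
    _ = exp (s * b) ^ n * twoPointMGF a b s := by unfold twoPointMGF; ring
    _ ≤ ((1 + b / -a) * twoPointMGF a b s) ^ n * twoPointMGF a b s := by gcongr
    _ = (1 + b / -a) ^ n * twoPointMGF a b s ^ (n + 1) := by
        rw [mul_pow]; ring

lemma one_add_div_pow_le_Upsilon {a b : ℝ} (ha : a < 0) (hb : 0 < b) (n : ℕ) :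
    (1 + b / -a) ^ n ≤ Upsilon (n + 1) a b := by
  have ha' : 0 < -a := neg_pos.2 ha
  unfold Upsilon
  rw [abs_of_neg ha]
  set r := max (-a) b / -a
  have hr : 1 ≤ r := (one_le_div ha').2 (le_max_left _ _)
  have hbr : b / -a ≤ r := div_le_div_of_nonneg_right (le_max_right _ _) ha'.le
  have hpow : (1 + b / -a) ^ n ≤ (1 + r) ^ n := by gcongr
  have hbern : 1 + (n : ℝ) * r ≤ (1 + r) ^ n := one_add_mul_le_pow (by linarith) n
  have hn : (n : ℝ) ≤ n * r := le_mul_of_one_le_right n.cast_nonneg hr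
  push_cast
  rw [pow_succ]
  nlinarith

theorem stmt_0 {Ω : Type*} [MeasureSpace Ω] [IsProbabilityMeasure (ℙ : Measure Ω)]
    (X : Ω → ℝ) (hX : Measurable X) (a b : ℝ) (ha : a < 0) (hb : 0 < b)
    (hmem : ∀ᵐ ω, X ω ∈ Set.Icc a b) (hmean : ∫ ω, X ω = 0)
    (s : ℝ) (hs : 0 < s) (k : ℕ) (hk : 1 ≤ k) :
    ∫ ω, Real.exp (s * X ω) ≤
      Upsilon k a b * Real.exp (s ^ 2 / (2 * k) * (Phi a b) ^ 2) := by
  obtain ⟨n, rfl⟩ : ∃ n, k = n + 1 := ⟨k - 1, by omega⟩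
  have hn : (0 : ℝ) < (n + 1 : ℕ) := by positivity
  have ht : 0 < s / (n + 1 : ℕ) := div_pos hs hn
  have hst : (n + 1 : ℕ) * (s / (n + 1 : ℕ)) = s := mul_div_cancel₀ s hn.ne'
  have hm : 0 ≤ twoPointMGF a b (s / (n + 1 : ℕ)) := by
    have h : 0 < b - a := by linarith
    have ha' : 0 < -a := neg_pos.2 ha
    unfold twoPointMGF
    positivity
  have hΥ := one_add_div_pow_le_Upsilon ha hb n
  have hpow : 0 ≤ (1 + b / -a) ^ n :=
    pow_nonneg (add_nonneg zero_le_one (div_nonneg hb.le (neg_pos.2 ha).le)) n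
  calc ∫ ω, Real.exp (s * X ω)
      ≤ twoPointMGF a b s :=
        integral_exp_le_twoPointMGF hX.aemeasurable (ha.trans hb) hmem hmean s
    _ ≤ (1 + b / -a) ^ n * twoPointMGF a b (s / (n + 1 : ℕ)) ^ (n + 1) := by
        have h := twoPointMGF_nat_mul_le ha hb ht.le n
        rwa [hst] at h
    _ ≤ Upsilon (n + 1) a b *
          Real.exp ((s / (n + 1 : ℕ)) ^ 2 / 2 * Phi a b ^ 2) ^ (n + 1) :=
        mul_le_mul hΥ (pow_le_pow_left₀ hm (twoPointMGF_le_exp_Phi ha hb ht.le) _)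
          (pow_nonneg hm _) (hpow.trans hΥ)
    _ = Upsilon (n + 1) a b *
          Real.exp (s ^ 2 / (2 * (n + 1 : ℕ)) * (Phi a b) ^ 2) := by
        rw [← Real.exp_nat_mul]
        congr 2
        field_simp
end

section
/- Let X be a real-valued random variable on a probability space with E[X] = 0 and X ∈ [a, b] almost surely, where a < 0 < b, and let m₂ = E[X²]. Then for every real s > 0, E[exp(sX)] ≤ (1 + m₂/a²) · exp( (s²/4) · Φ(a,b)² ), where Φ(a,b) = (|a|+b)/2 if b > |a| and Φ(a,b) = √(|a|·b) if b ≤ |a|. -/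
open MeasureTheory Real ProbabilityTheory
open scoped ProbabilityTheory

/-- The pointwise form of Hoeffding's lemma: the chord of `exp` over `[t * a, t * b]`, at `0`. -/
lemma exp_chord_le_exp_sq_div_eight {a b : ℝ} (ha : a < 0) (hb : 0 < b) (t : ℝ) :
    (b * exp (t * a) - a * exp (t * b)) / (b - a) ≤ exp (t ^ 2 * (b - a) ^ 2 / 8) := by
  have hba : 0 < b - a := by linarith
  have hp : 0 ≤ b / (b - a) := by positivity
  have hq : 0 ≤ -a / (b - a) := div_nonneg (by linarith) hba.le
  set μ : Measure ℝ := ENNReal.ofReal (b / (b - a)) • Measure.dirac a +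
    ENNReal.ofReal (-a / (b - a)) • Measure.dirac b with hμ
  have : IsProbabilityMeasure μ := by
    constructor
    simp only [hμ, Measure.coe_add, Measure.coe_smul, Pi.add_apply, Pi.smul_apply, measure_univ,
      smul_eq_mul, mul_one]
    rw [← ENNReal.ofReal_add hp hq, ← add_div, ← sub_eq_add_neg, div_self hba.ne',
      ENNReal.ofReal_one]
  have hint (f : ℝ → ℝ) : ∫ x, f x ∂μ = b / (b - a) * f a + -a / (b - a) * f b := by
    have hi (c : ℝ) (x : ℝ) : Integrable f (ENNReal.ofReal c • Measure.dirac x) :=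
      (integrable_dirac (by simp)).smul_measure ENNReal.ofReal_ne_top
    rw [hμ, integral_add_measure (hi _ _) (hi _ _), integral_smul_measure, integral_smul_measure,
      integral_dirac, integral_dirac, ENNReal.toReal_ofReal hp, ENNReal.toReal_ofReal hq,
      smul_eq_mul, smul_eq_mul]
  have hmem : ∀ᵐ x ∂μ, id x ∈ Set.Icc a b := by
    rw [hμ, ae_add_measure_iff]
    constructor <;> refine Measure.ae_smul_measure ?_ _ <;> rw [ae_dirac_eq] <;>
      simp <;> linarith
  have key := (hasSubgaussianMGF_of_mem_Icc_of_integral_eq_zero (μ := μ) aemeasurable_id hmem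
    (by rw [hint]; simp only [id]; ring)).mgf_le t
  rw [mgf, hint] at key
  simp only [id, NNReal.coe_pow, NNReal.coe_div, coe_nnnorm, norm_eq_abs, abs_of_pos hba,
    NNReal.coe_ofNat] at key
  calc _ = _ := by ring
    _ ≤ _ := key
    _ = _ := by ring_nf

lemma exp_sub_one_le_mul_exp_add_one_div_two {u : ℝ} (hu : 0 ≤ u) :
    exp u - 1 ≤ u * (1 + exp u) / 2 := by
  have hmono : MonotoneOn (fun u : ℝ => u * (1 + exp u) / 2 - exp u) (Set.Ici 0) := by
    have hd (x : ℝ) : HasDerivAt (fun u : ℝ => u * (1 + exp u) / 2 - exp u)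
        ((1 * (1 + exp x) + x * exp x) / 2 - exp x) x :=
      (((hasDerivAt_id x).mul ((Real.hasDerivAt_exp x).const_add 1)).div_const 2).sub
        (Real.hasDerivAt_exp x)
    refine monotoneOn_of_deriv_nonneg (convex_Ici 0)
      (fun x _ => (hd x).continuousAt.continuousWithinAt)
      (fun x _ => (hd x).differentiableAt.differentiableWithinAt) fun x _ => ?_
    rw [(hd x).deriv]
    have h1 : (1 - x) * exp x ≤ 1 := by
      calc (1 - x) * exp x ≤ exp (-x) * exp x := by gcongr; exact one_sub_le_exp_neg x
        _ = 1 := by rw [← exp_add]; simp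
    linarith
  have := hmono (Set.mem_Ici.2 le_rfl) hu hu
  simp at this
  linarith

/-- When `b ≤ -a`, the chord bound of Hoeffding's lemma improves from the arithmetic to the
geometric mean of `-a` and `b`. -/
lemma exp_chord_le_exp_sq_mul_div_two {a b t : ℝ} (hb : 0 < b) (hab : b ≤ -a)
    (ht : 0 ≤ t) :
    (b * exp (t * a) - a * exp (t * b)) / (b - a) ≤ exp (t ^ 2 * (-a * b) / 2) := by
  have hba : 0 < b - a := by linarith
  have hanti : AntitoneOn (fun t : ℝ => (b * exp (t * a) - a * exp (t * b)) *
      exp (t ^ 2 * (a * b) / 2)) (Set.Ici 0) := by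
    have hd (x : ℝ) := (((((hasDerivAt_id x).mul_const a).exp.const_mul b).sub
      (((hasDerivAt_id x).mul_const b).exp.const_mul a)).mul
      ((((hasDerivAt_id x).pow 2).mul_const (a * b)).div_const 2).exp)
    refine antitoneOn_of_deriv_nonpos (convex_Ici 0)
      (fun x _ => (hd x).continuousAt.continuousWithinAt)
      (fun x _ => (hd x).differentiableAt.differentiableWithinAt) fun x hx => ?_
    rw [interior_Ici, Set.mem_Ioi] at hx
    refine (hd x).deriv.trans_le ?_
    have hE : exp (x * b) = exp (x * a) * exp (x * (b - a)) := by rw [← exp_add]; ring_nf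
    have h1 := exp_sub_one_le_mul_exp_add_one_div_two (mul_nonneg hx.le hba.le)
    have h2 : 1 ≤ exp (x * (b - a)) := one_le_exp (mul_nonneg hx.le hba.le)
    have h3 : exp (x * (b - a)) - 1 ≤ x * (b - a * exp (x * (b - a))) := by
      nlinarith [mul_nonneg hx.le (mul_nonneg (by linarith : 0 ≤ -a - b) (sub_nonneg.2 h2))]
    have h4 : 0 ≤ (-a * b) * (exp (x * a) * exp (x ^ 2 * (a * b) / 2)) :=
      mul_nonneg (mul_nonneg (by linarith) hb.le) (by positivity)
    have h5 := mul_nonneg h4 (sub_nonneg.2 h3)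
    simp only [id, Pi.pow_apply, Pi.sub_apply, hE]
    norm_num
    linarith
  have h := hanti (Set.mem_Ici.2 le_rfl) ht ht
  have hinv : exp (t ^ 2 * (a * b) / 2) * exp (t ^ 2 * (-a * b) / 2) = 1 := by
    rw [← exp_add, ← exp_zero]; ring_nf
  simp only [zero_mul, exp_zero, mul_one, ne_eq, OfNat.ofNat_ne_zero, not_false_eq_true, zero_pow,
    zero_div] at h
  rw [div_le_iff₀ hba]
  calc _ = (b * exp (t * a) - a * exp (t * b)) * exp (t ^ 2 * (a * b) / 2) *
        exp (t ^ 2 * (-a * b) / 2) := by rw [mul_assoc, hinv, mul_one]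
    _ ≤ (b - a) * exp (t ^ 2 * (-a * b) / 2) := by gcongr
    _ = _ := mul_comm _ _

lemma exp_chord_le_exp_sq_mul_Phi_sq {a b t : ℝ} (ha : a < 0) (hb : 0 < b) (ht : 0 ≤ t) :
    (b * exp (t * a) - a * exp (t * b)) / (b - a) ≤ exp (t ^ 2 * Phi a b ^ 2 / 2) := by
  unfold Phi
  rw [abs_of_neg ha]
  split_ifs with h
  · refine (exp_chord_le_exp_sq_div_eight ha hb t).trans_eq ?_
    ring_nf
  · rw [sq_sqrt (mul_nonneg (by linarith) hb.le)]
    exact exp_chord_le_exp_sq_mul_div_two hb (not_lt.1 h) ht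

lemma exp_mul_le_chord {a b x : ℝ} (hab : a < b) (hx : x ∈ Set.Icc a b) (t : ℝ) :
    exp (t * x) ≤ (b * exp (t * a) - a * exp (t * b)) / (b - a) +
      (exp (t * b) - exp (t * a)) / (b - a) * x := by
  have hba : 0 < b - a := by linarith
  have h := convexOn_exp.2 (Set.mem_univ (t * a)) (Set.mem_univ (t * b))
    (div_nonneg (sub_nonneg.2 hx.2) hba.le) (div_nonneg (sub_nonneg.2 hx.1) hba.le)
    (by field_simp; ring)
  simp only [smul_eq_mul] at h
  calc exp (t * x) = exp ((b - x) / (b - a) * (t * a) + (x - a) / (b - a) * (t * b)) := by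
        congr 1; field_simp; ring
    _ ≤ _ := h
    _ = _ := by ring

theorem stmt_1 {Ω : Type*} [MeasureSpace Ω] [IsProbabilityMeasure (ℙ : Measure Ω)]
    (X : Ω → ℝ) (hX : Measurable X) (a b : ℝ) (ha : a < 0) (hb : 0 < b)
    (hmem : ∀ᵐ ω, X ω ∈ Set.Icc a b) (hmean : ∫ ω, X ω = 0)
    (m₂ : ℝ) (hm₂ : m₂ = ∫ ω, (X ω) ^ 2)
    (s : ℝ) (hs : 0 < s) :
    ∫ ω, Real.exp (s * X ω) ≤
      (1 + m₂ / a ^ 2) * Real.exp (s ^ 2 / 4 * (Phi a b) ^ 2) := by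
  have hba : 0 < b - a := by linarith
  have hchord := fun x (hx : x ∈ Set.Icc a b) => exp_mul_le_chord (by linarith) hx (s / 2)
  have hAle := exp_chord_le_exp_sq_mul_Phi_sq ha hb (half_pos hs).le
  have hBa : (exp (s / 2 * b) - exp (s / 2 * a)) / (b - a) * -a ≤
      (b * exp (s / 2 * a) - a * exp (s / 2 * b)) / (b - a) := by
    rw [div_mul_eq_mul_div]
    gcongr
    nlinarith [exp_pos (s / 2 * a)]
  have hB : 0 ≤ (exp (s / 2 * b) - exp (s / 2 * a)) / (b - a) := by
    refine div_nonneg (sub_nonneg.2 (exp_le_exp.2 ?_)) hba.le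
    gcongr
    linarith
  set A := (b * exp (s / 2 * a) - a * exp (s / 2 * b)) / (b - a)
  set B := (exp (s / 2 * b) - exp (s / 2 * a)) / (b - a)
  have hA : 0 ≤ A := (mul_nonneg hB (by linarith)).trans hBa
  have hLp : MemLp X 2 := memLp_of_bounded hmem hX.aestronglyMeasurable 2
  have hi1 : Integrable X := hLp.integrable one_le_two
  have hi2 : Integrable fun ω => X ω ^ 2 := hLp.integrable_sq
  have hm : 0 ≤ m₂ := hm₂ ▸ integral_nonneg fun ω => sq_nonneg _
  have hg : Integrable fun ω => A ^ 2 + 2 * A * B * X ω :=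
    (integrable_const _).add (hi1.const_mul _)
  have hBA : B ^ 2 ≤ A ^ 2 / a ^ 2 := by
    rw [le_div_iff₀ (sq_pos_of_neg ha), ← neg_sq a, ← mul_pow]
    exact pow_le_pow_left₀ (mul_nonneg hB (by linarith)) hBa 2
  calc ∫ ω, exp (s * X ω) ≤ ∫ ω, (A ^ 2 + 2 * A * B * X ω + B ^ 2 * X ω ^ 2) := by
        refine integral_mono_of_nonneg (ae_of_all _ fun ω => (exp_pos _).le)
          (hg.add (hi2.const_mul _)) ?_
        filter_upwards [hmem] with ω hω
        calc exp (s * X ω) = exp (s / 2 * X ω) ^ 2 := by rw [← exp_nat_mul]; ring_nf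
          _ ≤ (A + B * X ω) ^ 2 := by gcongr; exact hchord _ hω
          _ = _ := by ring
    _ = A ^ 2 + B ^ 2 * m₂ := by
        rw [integral_add hg (hi2.const_mul _),
          integral_add (integrable_const _) (hi1.const_mul _), integral_const_mul,
          integral_const_mul, hmean, ← hm₂]
        simp
    _ ≤ A ^ 2 + A ^ 2 / a ^ 2 * m₂ := by gcongr
    _ = (1 + m₂ / a ^ 2) * A ^ 2 := by ring
    _ ≤ (1 + m₂ / a ^ 2) * exp ((s / 2) ^ 2 * Phi a b ^ 2 / 2) ^ 2 := by gcongr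
    _ = _ := by
        rw [← exp_nat_mul]
        ring_nf
end

section
/- Let X be a real-valued random variable on a probability space with E[X] = 0 and X ∈ [a, b] almost surely, where a < 0 < b. Then for every real s > 0, E[exp(sX)] ≤ (1 + b/|a|) · exp( (s²/4) · Φ(a,b)² ), where Φ(a,b) = (|a|+b)/2 if b > |a| and Φ(a,b) = √(|a|·b) if b ≤ |a|. -/
open MeasureTheory Real ProbabilityTheory
open scoped ProbabilityTheory

theorem exp_le_of_mem_Icc {a b x : ℝ} (s : ℝ) (hab : a < b) (hx : x ∈ Set.Icc a b) :
    exp (s * x) ≤ (b - x) / (b - a) * exp (s * a) + (x - a) / (b - a) * exp (s * b) := by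
  have h : 0 < b - a := sub_pos.2 hab
  have key := convexOn_exp.2 (Set.mem_univ (s * a)) (Set.mem_univ (s * b))
    (div_nonneg (sub_nonneg.2 hx.2) h.le) (div_nonneg (sub_nonneg.2 hx.1) h.le)
    (by field_simp; ring)
  simp only [smul_eq_mul] at key
  have hx' : s * x = (b - x) / (b - a) * (s * a) + (x - a) / (b - a) * (s * b) := by
    field_simp
    ring
  rwa [← hx'] at key

theorem integral_exp_le_of_mem_Icc {Ω : Type*} [MeasurableSpace Ω] {μ : Measure Ω}
    [IsProbabilityMeasure μ] {X : Ω → ℝ} (hX : AEMeasurable X μ) {a b : ℝ} (hab : a < b)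
    (hmem : ∀ᵐ ω ∂μ, X ω ∈ Set.Icc a b) (hmean : ∫ ω, X ω ∂μ = 0) (s : ℝ) :
    ∫ ω, exp (s * X ω) ∂μ ≤ (b * exp (s * a) - a * exp (s * b)) / (b - a) := by
  have hint : Integrable X μ := .of_mem_Icc a b hX hmem
  have h : b - a ≠ 0 := (sub_pos.2 hab).ne'
  have hlin (ω : Ω) : (b - X ω) / (b - a) * exp (s * a) + (X ω - a) / (b - a) * exp (s * b) =
      (b * exp (s * a) - a * exp (s * b)) / (b - a) +
        (exp (s * b) - exp (s * a)) / (b - a) * X ω := by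
    field_simp
    ring
  calc ∫ ω, exp (s * X ω) ∂μ
      ≤ ∫ ω, ((b * exp (s * a) - a * exp (s * b)) / (b - a) +
          (exp (s * b) - exp (s * a)) / (b - a) * X ω) ∂μ := by
        refine integral_mono_of_nonneg (.of_forall fun ω ↦ (exp_pos _).le)
          ((integrable_const _).add (hint.const_mul _)) ?_
        filter_upwards [hmem] with ω hω
        exact (exp_le_of_mem_Icc s hab hω).trans_eq (hlin ω)
    _ = (b * exp (s * a) - a * exp (s * b)) / (b - a) := by
        rw [integral_add (integrable_const _) (hint.const_mul _), integral_const_mul, hmean]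
        simp

theorem exp_sq_le_one_add_add_sq {b : ℝ} (hb : 1 ≤ b) :
    exp ((2 * b / (1 + b)) ^ 2) ≤ 1 + b + b ^ 2 := by
  have hder (x : ℝ) (hx : 1 ≤ x) :
      HasDerivAt (fun y : ℝ ↦ log (1 + y + y ^ 2) - (2 * y / (1 + y)) ^ 2)
        ((1 + 2 * x) / (1 + x + x ^ 2) - 8 * x / (1 + x) ^ 3) x := by
    have h1 : 1 + x ≠ 0 := by positivity
    have h2 : 1 + x + x ^ 2 ≠ 0 := by positivity
    have d1 : HasDerivAt (fun y : ℝ ↦ 1 + y) 1 x := (hasDerivAt_id x).const_add 1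
    have d2 : HasDerivAt (fun y : ℝ ↦ 1 + y + y ^ 2) (1 + 2 * x) x := by
      simpa using d1.fun_add (hasDerivAt_pow 2 x)
    have d3 : HasDerivAt (fun y : ℝ ↦ 2 * y) 2 x := by
      simpa using (hasDerivAt_id x).const_mul (2 : ℝ)
    refine ((d2.log h2).fun_sub ((d3.fun_div d1 h1).fun_pow 2)).congr_deriv ?_
    norm_num only [pow_one, Nat.cast_ofNat]
    field_simp
    ring
  have hmono : MonotoneOn (fun y : ℝ ↦ log (1 + y + y ^ 2) - (2 * y / (1 + y)) ^ 2)
      (Set.Ici 1) := by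
    refine monotoneOn_of_deriv_nonneg (convex_Ici 1)
      (fun x hx ↦ (hder x hx).continuousAt.continuousWithinAt)
      (fun x hx ↦ (hder x (interior_subset hx)).differentiableAt.differentiableWithinAt)
      fun x hx ↦ ?_
    have hx1 : 1 ≤ x := interior_subset hx
    rw [(hder x hx1).deriv, sub_nonneg, div_le_div_iff₀ (by positivity) (by positivity)]
    have : 0 ≤ (x - 1) * (2 * x ^ 3 + x ^ 2 + 2 * x - 1) :=
      mul_nonneg (by linarith) (by nlinarith [pow_pos (by linarith : 0 < x) 3, sq_nonneg x])
    linarith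
  have h := hmono Set.self_mem_Ici hb hb
  have h3 : 1 ≤ log 3 := by
    rw [le_log_iff_exp_le (by norm_num)]
    exact exp_one_lt_d9.le.trans (by norm_num)
  norm_num at h
  rw [← le_log_iff_exp_le (by positivity)]
  linarith

theorem mul_exp_neg_add_exp_le {t β c d : ℝ} (ht : 0 ≤ t) (hβ : 0 ≤ β) (hc : 0 ≤ c)
    (hd : t * β ≤ d + c) (hexp : exp d ≤ 1 + β + β ^ 2) :
    β * exp (-t) + exp (t * β) ≤ (1 + β) ^ 2 * exp c := by
  have h1 : exp (-t) ≤ exp c := exp_le_exp.2 (by linarith)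
  have h2 : exp (t * β) ≤ exp d * exp c := by
    rw [← exp_add]
    exact exp_le_exp.2 hd
  nlinarith [mul_le_mul_of_nonneg_left h1 hβ, mul_le_mul_of_nonneg_right hexp (exp_pos c).le]

theorem stmt_2 {Ω : Type*} [MeasureSpace Ω] [IsProbabilityMeasure (ℙ : Measure Ω)]
    (X : Ω → ℝ) (hX : Measurable X) (a b : ℝ) (ha : a < 0) (hb : 0 < b)
    (hmem : ∀ᵐ ω, X ω ∈ Set.Icc a b) (hmean : ∫ ω, X ω = 0)
    (s : ℝ) (hs : 0 < s) :
    ∫ ω, Real.exp (s * X ω) ≤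
      (1 + b / |a|) * Real.exp (s ^ 2 / 4 * (Phi a b) ^ 2) := by
  have hα : |a| = -a := abs_of_neg ha
  have hα0 : 0 < -a := neg_pos.2 ha
  have hβ : 0 < b / -a := div_pos hb hα0
  have hcancel : b / -a * -a = b := div_mul_cancel₀ b hα0.ne'
  have key : b / -a * exp (-(s * -a)) + exp (s * -a * (b / -a)) ≤
      (1 + b / -a) ^ 2 * exp (s ^ 2 / 4 * Phi a b ^ 2) := by
    have hc : 0 ≤ s ^ 2 / 4 * Phi a b ^ 2 := by positivity
    have ht : 0 ≤ s * -a := by positivity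
    have hsb : s * -a * (b / -a) = s * b := by rw [mul_assoc, mul_comm (-a), hcancel]
    rcases lt_or_ge (-a) b with h | h
    · refine mul_exp_neg_add_exp_le ht hβ.le hc ?_
        (exp_sq_le_one_add_add_sq ((one_le_div hα0).2 h.le))
      have hu : 2 * (b / -a) / (1 + b / -a) * ((-a + b) / 2) = b := by
        have : 1 + b / -a ≠ 0 := by positivity
        rw [div_mul_eq_mul_div, div_eq_iff this]
        linear_combination hcancel
      rw [hsb, Phi, hα, if_pos h]
      set u := 2 * (b / -a) / (1 + b / -a)
      nlinarith [sq_nonneg (u - s / 2 * ((-a + b) / 2))]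
    · have hβ1 : b / -a ≤ 1 := (div_le_one hα0).2 h
      refine mul_exp_neg_add_exp_le (d := b / -a) ht hβ.le hc ?_ ?_
      · rw [Phi, hα, if_neg h.not_gt, sq_sqrt (by positivity)]
        have : s ^ 2 / 4 * (-a * b) = (s * -a) ^ 2 / 4 * (b / -a) := by
          nth_rewrite 1 [← hcancel]
          ring
        rw [this]
        nlinarith [mul_nonneg hβ.le (sq_nonneg (s * -a / 2 - 1))]
      · have := (abs_le.1 (abs_exp_sub_one_sub_id_le (abs_le.2 ⟨by linarith, hβ1⟩))).2
        linarith
  refine (integral_exp_le_of_mem_Icc hX.aemeasurable (ha.trans hb) hmem hmean s).trans ?_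
  have hfac : (b * exp (s * a) - a * exp (s * b)) / (b - a) =
      (b / -a * exp (-(s * -a)) + exp (s * -a * (b / -a))) / (1 + b / -a) := by
    have h1 : b - a ≠ 0 := by linarith
    have h2 : 1 + b / -a ≠ 0 := by positivity
    rw [mul_assoc s, mul_comm (-a), hcancel, mul_neg, neg_neg, div_eq_div_iff h1 h2]
    linear_combination (exp (s * b) - exp (s * a)) * hcancel
  rw [hfac, hα, div_le_iff₀ (by positivity)]
  linarith
end

section
/- Let X be a real-valued random variable on a probability space with E[X] = 0 and X ∈ [a, b] almost surely, where a < 0 < b. Then E[X⁴] ≤ |a|·b·(a² + a·b + b²), and consequently E[X⁴] ≤ |a|·b·(a² + b²). -/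
open MeasureTheory Real ProbabilityTheory
open scoped ProbabilityTheory

/-- On `[a, b]` the function `x ↦ x ^ 4` lies below its chord. -/
lemma pow_four_le_chord {a b x : ℝ} (hx : x ∈ Set.Icc a b) :
    x ^ 4 ≤ (a + b) * (a ^ 2 + b ^ 2) * x + -a * b * (a ^ 2 + a * b + b ^ 2) := by
  have h := mul_nonneg (mul_nonneg (sub_nonneg.2 hx.1) (sub_nonneg.2 hx.2))
    (by positivity : 0 ≤ (x + a) ^ 2 + (x + b) ^ 2 + (a + b) ^ 2)
  linarith

theorem stmt_6 {Ω : Type*} [MeasureSpace Ω] [IsProbabilityMeasure (ℙ : Measure Ω)]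
    (X : Ω → ℝ) (hX : Measurable X) (a b : ℝ) (ha : a < 0) (hb : 0 < b)
    (hmem : ∀ᵐ ω, X ω ∈ Set.Icc a b) (hmean : ∫ ω, X ω = 0) :
    (∫ ω, (X ω) ^ 4 ≤ |a| * b * (a ^ 2 + a * b + b ^ 2)) ∧
      (∫ ω, (X ω) ^ 4 ≤ |a| * b * (a ^ 2 + b ^ 2)) := by
  have hint : Integrable X := Integrable.of_mem_Icc a b hX.aemeasurable hmem
  have hlin : Integrable fun ω => (a + b) * (a ^ 2 + b ^ 2) * X ω := hint.const_mul _
  have key : ∫ ω, (X ω) ^ 4 ≤ |a| * b * (a ^ 2 + a * b + b ^ 2) := by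
    calc ∫ ω, (X ω) ^ 4
        ≤ ∫ ω, ((a + b) * (a ^ 2 + b ^ 2) * X ω + -a * b * (a ^ 2 + a * b + b ^ 2)) := by
          refine integral_mono_of_nonneg (.of_forall fun ω => by positivity)
            (hlin.add (integrable_const _)) ?_
          filter_upwards [hmem] with ω hω using pow_four_le_chord hω
      _ = |a| * b * (a ^ 2 + a * b + b ^ 2) := by
          rw [integral_add hlin (integrable_const _), integral_const_mul, hmean, abs_of_neg ha]
          simp
  refine ⟨key, key.trans ?_⟩
  have hab : a * b ≤ 0 := mul_nonpos_of_nonpos_of_nonneg ha.le hb.le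
  gcongr
  linarith
end

section
/- For 0 < λ < 1 and u > 0, define ψ(u) = −λu + ln(1 − λ + λ·e^u). Then there exists ξ ∈ [0, u] such that ψ(u) = (1/2)·τ·(1−τ)·u², where τ = λ / ((1−λ)·e^{−ξ} + λ). -/
open Real

/-- Second-order Taylor formula with Lagrange remainder, in terms of explicit derivatives. -/
theorem exists_eq_taylor_two_of_hasDerivAt {f f' f'' : ℝ → ℝ} {a b : ℝ} (hab : a < b)
    (hf : ∀ x ∈ Set.Icc a b, HasDerivAt f (f' x) x)
    (hf' : ∀ x ∈ Set.Icc a b, HasDerivAt f' (f'' x) x) :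
    ∃ ξ ∈ Set.Ioo a b, f b = f a + f' a * (b - a) + 1 / 2 * f'' ξ * (b - a) ^ 2 := by
  have hF : ∀ x ∈ Set.Icc a b,
      HasDerivAt (fun y => f y + f' y * (b - y)) (f'' x * (b - x)) x := by
    intro x hx
    refine ((hf x hx).add ((hf' x hx).mul ((hasDerivAt_id x).const_sub b))).congr_deriv ?_
    simp
  have hG : ∀ x, HasDerivAt (fun y => (b - y) ^ 2) (-2 * (b - x)) x := by
    intro x
    refine (((hasDerivAt_id x).const_sub b).pow 2).congr_deriv ?_
    simp
  obtain ⟨c, hc, h⟩ := exists_ratio_hasDerivAt_eq_ratio_slope _ _ hab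
    (fun x hx => (hF x hx).continuousAt.continuousWithinAt)
    (fun x hx => hF x (Set.Ioo_subset_Icc_self hx)) _ _
    (fun x _ => (hG x).continuousAt.continuousWithinAt) (fun x _ => hG x)
  have hbc : b - c ≠ 0 := (sub_pos.2 hc.2).ne'
  refine ⟨c, hc, mul_right_cancel₀ hbc ?_⟩
  linear_combination 1 / 2 * h

theorem hasDerivAt_log_one_sub_add_mul_exp {p : ℝ} (hp₀ : 0 < p) (hp₁ : p < 1) (x : ℝ) :
    HasDerivAt (fun y => -p * y + Real.log (1 - p + p * Real.exp y))
      (-p + p / ((1 - p) * Real.exp (-x) + p)) x := by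
  have hq : 0 < 1 - p := sub_pos.2 hp₁
  have hpos : 0 < 1 - p + p * Real.exp x := by positivity
  have h := ((hasDerivAt_id x).const_mul (-p)).add
    ((((Real.hasDerivAt_exp x).const_mul p).const_add (1 - p)).log hpos.ne')
  refine h.congr_deriv ?_
  have hpos' : 0 < (1 - p) * Real.exp (-x) + p := by positivity
  have he : Real.exp (-x) * Real.exp x = 1 := by rw [← Real.exp_add]; simp
  rw [mul_one, add_right_inj, div_eq_div_iff hpos.ne' hpos'.ne']
  linear_combination p * (1 - p) * he

theorem hasDerivAt_div_mul_exp_neg_add {p : ℝ} (hp₀ : 0 < p) (hp₁ : p < 1) (x : ℝ) :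
    HasDerivAt (fun y => p / ((1 - p) * Real.exp (-y) + p))
      (p / ((1 - p) * Real.exp (-x) + p) * (1 - p / ((1 - p) * Real.exp (-x) + p))) x := by
  have hq : 0 < 1 - p := sub_pos.2 hp₁
  have hpos : 0 < (1 - p) * Real.exp (-x) + p := by positivity
  have h := (hasDerivAt_const x p).div
    (((hasDerivAt_neg x).exp.const_mul (1 - p)).add_const p) hpos.ne'
  refine h.congr_deriv ?_
  field_simp
  ring

theorem stmt_7 (lam u : ℝ) (hlam₀ : 0 < lam) (hlam₁ : lam < 1) (hu : 0 < u) :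
    ∃ ξ ∈ Set.Icc (0 : ℝ) u,
      -lam * u + Real.log (1 - lam + lam * Real.exp u) =
        1 / 2 * (lam / ((1 - lam) * Real.exp (-ξ) + lam)) *
          (1 - lam / ((1 - lam) * Real.exp (-ξ) + lam)) * u ^ 2 := by
  obtain ⟨ξ, hξ, h⟩ := exists_eq_taylor_two_of_hasDerivAt hu
    (fun x _ => hasDerivAt_log_one_sub_add_mul_exp hlam₀ hlam₁ x)
    (fun x _ => (hasDerivAt_div_mul_exp_neg_add hlam₀ hlam₁ x).const_add (-lam))
  refine ⟨ξ, Set.Ioo_subset_Icc_self hξ, ?_⟩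
  simpa [mul_assoc] using h
end

section
/- For 0 < λ < 1 and u > 0, define ψ(u) = −λu + ln(1 − λ + λ·e^u). Then ψ(u) ≤ u²/8 if λ ≤ 1/2, and ψ(u) ≤ λ(1−λ)·u²/2 if λ > 1/2. -/
open Real

theorem monotoneOn_Ici_of_hasDerivAt_nonneg {f f' : ℝ → ℝ} {a : ℝ}
    (hf : ∀ x, HasDerivAt f (f' x) x) (hf' : ∀ x, a ≤ x → 0 ≤ f' x) :
    MonotoneOn f (Set.Ici a) := by
  refine monotoneOn_of_deriv_nonneg (convex_Ici a)
    (fun x _ => (hf x).continuousAt.continuousWithinAt)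
    (fun x _ => (hf x).differentiableAt.differentiableWithinAt) fun x hx => ?_
  rw [(hf x).deriv]
  exact hf' x (interior_subset hx)

/-- If the second derivative of the centred Bernoulli cumulant generating function is at most `c`
on the nonnegative half-line, the function is at most `c * u ^ 2 / 2` there. -/
theorem bernoulli_cgf_le_of_variance_le {p c u : ℝ} (hp₀ : 0 < p) (hp₁ : p < 1) (hu : 0 ≤ u)
    (hc : ∀ x, 0 ≤ x → p * (1 - p) * exp x ≤ c * (1 - p + p * exp x) ^ 2) :
    -p * u + log (1 - p + p * exp u) ≤ c * u ^ 2 / 2 := by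
  have hpos : ∀ x, 0 < 1 - p + p * exp x := fun x => by
    have := mul_pos hp₀ (exp_pos x)
    linarith
  have hD : ∀ x, HasDerivAt (fun x => 1 - p + p * exp x) (p * exp x) x := fun x =>
    ((hasDerivAt_exp x).const_mul p).const_add (1 - p)
  have hslope : ∀ x, HasDerivAt (fun x => c * x + p - p * exp x / (1 - p + p * exp x))
      (c - p * (1 - p) * exp x / (1 - p + p * exp x) ^ 2) x := fun x => by
    have h := (((hasDerivAt_id x).const_mul c).add_const p).sub
      (((hasDerivAt_exp x).const_mul p).div (hD x) (hpos x).ne')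
    refine h.congr_deriv ?_
    ring
  have hslope_nonneg : ∀ x, 0 ≤ x → 0 ≤ c * x + p - p * exp x / (1 - p + p * exp x) := by
    intro x hx
    have h := monotoneOn_Ici_of_hasDerivAt_nonneg hslope
      (fun y hy => sub_nonneg.2 ((div_le_iff₀ (pow_pos (hpos y) 2)).2 (hc y hy)))
      Set.self_mem_Ici hx hx
    simpa using h
  have hgap : ∀ x, HasDerivAt (fun x => c * x ^ 2 / 2 - (-p * x + log (1 - p + p * exp x)))
      (c * x + p - p * exp x / (1 - p + p * exp x)) x := fun x => by
    have h := ((((hasDerivAt_id x).pow 2).const_mul c).div_const 2).sub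
      (((hasDerivAt_id x).const_mul (-p)).add ((hD x).log (hpos x).ne'))
    refine h.congr_deriv ?_
    simp
    ring
  have h := monotoneOn_Ici_of_hasDerivAt_nonneg hgap hslope_nonneg Set.self_mem_Ici hu hu
  simpa using h

theorem stmt_8 (lam u : ℝ) (hlam₀ : 0 < lam) (hlam₁ : lam < 1) (hu : 0 < u) :
    (lam ≤ 1 / 2 → -lam * u + Real.log (1 - lam + lam * Real.exp u) ≤ u ^ 2 / 8) ∧
      (lam > 1 / 2 →
        -lam * u + Real.log (1 - lam + lam * Real.exp u) ≤ lam * (1 - lam) * u ^ 2 / 2) := by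
  refine ⟨fun _ => ?_, fun h => ?_⟩
  · have := bernoulli_cgf_le_of_variance_le (c := 1 / 4) hlam₀ hlam₁ hu.le fun x _ => by
      nlinarith [sq_nonneg (1 - lam - lam * exp x)]
    linarith
  · refine bernoulli_cgf_le_of_variance_le hlam₀ hlam₁ hu.le fun x hx => ?_
    have hvar : 0 ≤ lam * (1 - lam) := mul_nonneg hlam₀.le (by linarith)
    refine mul_le_mul_of_nonneg_left ?_ hvar
    have hexp : 0 ≤ exp x - 1 := sub_nonneg.2 (one_le_exp hx)
    nlinarith [sq_nonneg (lam * (exp x - 1)), mul_nonneg (by linarith : 0 ≤ 2 * lam - 1) hexp]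
end

section
/- Let X be a real-valued random variable on a probability space with E[X] = 0 and X ∈ [a, b] almost surely, where a < 0 < b, and let m₂ = E[X²]. Then for every real s > 0, E[exp(sX)] ≤ ((b² + m₂)/(b−a)²)·exp(sa) + ((m₂ + a²)/(b−a)²)·exp(sb) + ((−2ab − 2m₂)/(b−a)²)·exp(s(a+b)/2). -/
open MeasureTheory Real ProbabilityTheory
open scoped ProbabilityTheory

/-- Squaring the chord bound for `exp (s * x / 2)` bounds `exp (s * x)` on `[a, b]` by a
quadratic polynomial in `x`. -/
theorem exp_mul_le_sq_chord {a b x : ℝ} (hab : a < b) (hx : x ∈ Set.Icc a b) (s : ℝ) :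
    exp (s * x) ≤
      (b - x) ^ 2 / (b - a) ^ 2 * exp (s * a) + (x - a) ^ 2 / (b - a) ^ 2 * exp (s * b) +
        2 * ((b - x) * (x - a)) / (b - a) ^ 2 * exp (s * (a + b) / 2) := by
  have hd : 0 < b - a := sub_pos.2 hab
  have hd_ne : b - a ≠ 0 := hd.ne'
  have hchord : exp (s * x / 2) ≤
      (b - x) / (b - a) * exp (s * a / 2) + (x - a) / (b - a) * exp (s * b / 2) := by
    have h := convexOn_exp.2 (Set.mem_univ (s * a / 2)) (Set.mem_univ (s * b / 2))
      (div_nonneg (sub_nonneg.2 hx.2) hd.le) (div_nonneg (sub_nonneg.2 hx.1) hd.le)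
      (by field_simp; ring)
    simp only [smul_eq_mul] at h
    rwa [show (b - x) / (b - a) * (s * a / 2) + (x - a) / (b - a) * (s * b / 2) = s * x / 2 by
      field_simp; ring] at h
  have hexp (t : ℝ) : exp t = exp (t / 2) ^ 2 := by
    rw [← exp_nat_mul]
    congr 1
    push_cast
    ring
  have hmid : exp (s * (a + b) / 2) = exp (s * a / 2) * exp (s * b / 2) := by
    rw [← exp_add]
    congr 1
    ring
  rw [hexp (s * x), hexp (s * a), hexp (s * b), hmid]
  calc exp (s * x / 2) ^ 2
      ≤ ((b - x) / (b - a) * exp (s * a / 2) + (x - a) / (b - a) * exp (s * b / 2)) ^ 2 := by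
        gcongr
    _ = _ := by field_simp; ring

theorem stmt_9 {Ω : Type*} [MeasureSpace Ω] [IsProbabilityMeasure (ℙ : Measure Ω)]
    (X : Ω → ℝ) (hX : Measurable X) (a b : ℝ) (ha : a < 0) (hb : 0 < b)
    (hmem : ∀ᵐ ω, X ω ∈ Set.Icc a b) (hmean : ∫ ω, X ω = 0)
    (m₂ : ℝ) (hm₂ : m₂ = ∫ ω, (X ω) ^ 2)
    (s : ℝ) (hs : 0 < s) :
    ∫ ω, Real.exp (s * X ω) ≤
      (b ^ 2 + m₂) / (b - a) ^ 2 * Real.exp (s * a) +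
        (m₂ + a ^ 2) / (b - a) ^ 2 * Real.exp (s * b) +
          (-2 * a * b - 2 * m₂) / (b - a) ^ 2 * Real.exp (s * (a + b) / 2) := by
  have hL2 : MemLp X 2 (ℙ : Measure Ω) := memLp_of_bounded hmem hX.aestronglyMeasurable 2
  have hint : Integrable X (ℙ : Measure Ω) := hL2.integrable one_le_two
  have hint_sq : Integrable (fun ω => X ω ^ 2) (ℙ : Measure Ω) := hL2.integrable_sq
  have hint_exp : Integrable (fun ω => exp (s * X ω)) (ℙ : Measure Ω) :=
    integrable_exp_mul_of_mem_Icc hX.aemeasurable hmem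
  set A := exp (s * a) / (b - a) ^ 2 with hA
  set B := exp (s * b) / (b - a) ^ 2 with hB
  set C := exp (s * (a + b) / 2) / (b - a) ^ 2 with hC
  have hquad : Integrable (fun ω => (b ^ 2 * A + a ^ 2 * B - 2 * a * b * C) +
      (-2 * b * A - 2 * a * B + 2 * (a + b) * C) * X ω) (ℙ : Measure Ω) :=
    (integrable_const _).add (hint.const_mul _)
  calc ∫ ω, exp (s * X ω)
      ≤ ∫ ω, ((b ^ 2 * A + a ^ 2 * B - 2 * a * b * C) +
          (-2 * b * A - 2 * a * B + 2 * (a + b) * C) * X ω + (A + B - 2 * C) * X ω ^ 2) := by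
        refine integral_mono_ae hint_exp (hquad.add (hint_sq.const_mul _)) ?_
        filter_upwards [hmem] with ω hω
        refine (exp_mul_le_sq_chord (ha.trans hb) hω s).trans_eq ?_
        rw [hA, hB, hC]
        ring
    _ = (b ^ 2 * A + a ^ 2 * B - 2 * a * b * C) + (A + B - 2 * C) * m₂ := by
        rw [integral_add hquad (hint_sq.const_mul _),
          integral_add (integrable_const _) (hint.const_mul _), integral_const_mul,
          integral_const_mul, hmean, ← hm₂]
        simp
    _ = _ := by
        rw [hA, hB, hC]
        ring
end
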